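/- Let p be an arrangement on the order-3 permutohedron that minimizes ⟨d⟩ over all its rearrangements, i.e. ⟨d⟩(p) ≤ ⟨d⟩(p ∘ g) for every g ∈ Equiv.Perm (Fin 6). Then P_p(3) ≤ min(P_p(0), 1 - P_p(0), P_p(1)/2, P_p(2)/2). -/

import Mathlib

noncomputable section
open scoped Classical

/-- swap distance on the order-3 permutohedron (the 6-cycle on `Fin 6`) -/
def dd (i j : Fin 6) : ℕ := min ((i.val + 6 - j.val) % 6) ((j.val + 6 - i.val) % 6)

/-- average swap distance -/
def avgd (p : Fin 6 → ℝ) : ℝ := ∑ i, ∑ j, p i * p j * (dd i j : ℝ)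

/-- probability mass of swap distance `c` -/
def Pd (p : Fin 6 → ℝ) (c : ℕ) : ℝ := ∑ i, ∑ j, if dd i j = c then p i * p j else 0

theorem avgd_eq (p : Fin 6 → ℝ) :
    avgd p = 2 * (p 0 * p 1 + p 1 * p 2 + p 2 * p 3 + p 3 * p 4 + p 4 * p 5 + p 5 * p 0)
      + 4 * (p 0 * p 2 + p 1 * p 3 + p 2 * p 4 + p 3 * p 5 + p 4 * p 0 + p 5 * p 1)
      + 6 * (p 0 * p 3 + p 1 * p 4 + p 2 * p 5) := by
  simp [avgd, Fin.sum_univ_six, dd, -Nat.cast_min]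
  ring

theorem Pd_zero_eq (p : Fin 6 → ℝ) :
    Pd p 0 = p 0 ^ 2 + p 1 ^ 2 + p 2 ^ 2 + p 3 ^ 2 + p 4 ^ 2 + p 5 ^ 2 := by
  simp [Pd, Fin.sum_univ_six, dd]
  ring

theorem Pd_one_eq (p : Fin 6 → ℝ) :
    Pd p 1 = 2 * (p 0 * p 1 + p 1 * p 2 + p 2 * p 3 + p 3 * p 4 + p 4 * p 5 + p 5 * p 0) := by
  simp [Pd, Fin.sum_univ_six, dd]
  ring

theorem Pd_two_eq (p : Fin 6 → ℝ) :
    Pd p 2 = 2 * (p 0 * p 2 + p 1 * p 3 + p 2 * p 4 + p 3 * p 5 + p 4 * p 0 + p 5 * p 1) := by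
  simp [Pd, Fin.sum_univ_six, dd]
  ring

theorem Pd_three_eq (p : Fin 6 → ℝ) :
    Pd p 3 = 2 * (p 0 * p 3 + p 1 * p 4 + p 2 * p 5) := by
  simp [Pd, Fin.sum_univ_six, dd]
  ring

/-- The two conditions say that exchanging `a` with `b`, or `d` with `e`, in the cyclic
arrangement `a, b, c, d, e, f` does not lower the average swap distance. -/
theorem mul_nonneg_of_adjacent_swaps {a b c d e f : ℝ}
    (hab : 0 ≤ (a - b) * (e + f - c - d)) (hde : 0 ≤ (d - e) * (b + c - f - a)) :
    0 ≤ (a - b) * (e - d) := by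
  by_contra! h
  rcases mul_neg_iff.1 h with ⟨h1, h2⟩ | ⟨h1, h2⟩
  · have h3 := nonneg_of_mul_nonneg_right hab h1
    have h4 := nonneg_of_mul_nonneg_right hde (by linarith : 0 < d - e)
    linarith
  · have h3 := nonpos_of_mul_nonneg_right hab h1
    have h4 := nonpos_of_mul_nonneg_right hde (by linarith : d - e < 0)
    linarith

/-- in minimum-⟨d⟩ arrangements,
`P(3) ≤ min(P(0), 1 - P(0), P(1)/2, P(2)/2)`. -/
theorem stmt_14 (p : Fin 6 → ℝ) (hp0 : ∀ i, 0 ≤ p i) (hp1 : ∑ i, p i = 1)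
    (hmin : ∀ g : Equiv.Perm (Fin 6), avgd p ≤ avgd (p ∘ ⇑g)) :
    Pd p 3 ≤ min (Pd p 0) (min (1 - Pd p 0) (min (Pd p 1 / 2) (Pd p 2 / 2))) := by
  have swap_le (i j : Fin 6) := hmin (Equiv.swap i j)
  simp only [avgd_eq, Function.comp_apply, Equiv.swap_apply_def] at swap_le
  have h02 := swap_le 0 2
  have h13 := swap_le 1 3
  have h24 := swap_le 2 4
  have h01 := swap_le 0 1
  have h12 := swap_le 1 2
  have h23 := swap_le 2 3
  have h34 := swap_le 3 4
  have h45 := swap_le 4 5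
  have h50 := swap_le 5 0
  simp [Fin.ext_iff] at h02 h13 h24 h01 h12 h23 h34 h45 h50
  have k03 : 0 ≤ (p 0 - p 1) * (p 4 - p 3) :=
    mul_nonneg_of_adjacent_swaps (c := p 2) (f := p 5) (by linarith) (by linarith)
  have k14 : 0 ≤ (p 1 - p 2) * (p 5 - p 4) :=
    mul_nonneg_of_adjacent_swaps (c := p 3) (f := p 0) (by linarith) (by linarith)
  have k25 : 0 ≤ (p 2 - p 3) * (p 0 - p 5) :=
    mul_nonneg_of_adjacent_swaps (c := p 4) (f := p 1) (by linarith) (by linarith)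
  have nonneg (i j : Fin 6) : 0 ≤ p i * p j := mul_nonneg (hp0 i) (hp0 j)
  have hsq : (∑ i, p i) ^ 2 = 1 := by rw [hp1, one_pow]
  rw [Fin.sum_univ_six] at hsq
  rw [Pd_zero_eq, Pd_one_eq, Pd_two_eq, Pd_three_eq]
  refine le_min ?_ (le_min ?_ (le_min ?_ ?_))
  · linarith [sq_nonneg (p 0 - p 3), sq_nonneg (p 1 - p 4), sq_nonneg (p 2 - p 5)]
  · linarith [nonneg 0 1, nonneg 1 2, nonneg 2 3, nonneg 3 4, nonneg 4 5, nonneg 5 0,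
      nonneg 0 2, nonneg 1 3, nonneg 2 4, nonneg 3 5, nonneg 4 0, nonneg 5 1]
  · linarith
  · linarith
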